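/- Under the centered model and for any λ ≥ 0, the quartic population loss L^h_λ is twice differentiable on ℝ × ℝ^d and its gradient is given in closed form by: ∂_α L^h_λ(α, β) = α(α² + 3(β^⊤μ)² + 3‖β‖₂² + λ − 1), and ∇_β L^h_λ(α, β) = [3α² + (β^⊤μ)² + 3‖β‖₂² − 1](μ^⊤β)μ + [3α² + 3(μ^⊤β)² + M_Z‖β‖₂² − 1]β. -/

import Mathlib

open MeasureTheory ProbabilityTheory
open scoped RealInnerProductSpace

/-- `ℝ^d` with the Euclidean norm. -/
abbrev Vec (d : ℕ) := EuclideanSpace ℝ (Fin d)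

/-- `ℝ × ℝ^d` with the Euclidean (ℓ²) norm, the domain of the loss `(α, β) ↦ L(α, β)`. -/
abbrev Pr (d : ℕ) := WithLp 2 (ℝ × Vec d)

/-- Build the point `(α, β) ∈ ℝ × ℝ^d`. -/
noncomputable def mkp {d : ℕ} (α : ℝ) (β : Vec d) : Pr d :=
  (WithLp.equiv 2 (ℝ × Vec d)).symm (α, β)

/-- The quartic loss `h(x) = (x² - 1)² / 4`. -/
noncomputable def hq (x : ℝ) : ℝ := (x ^ 2 - 1) ^ 2 / 4

/-- The population loss `γ = (α, β) ↦ E g(α + β⊤X) + (λ/2) α²` built from a scalar loss `g`. -/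
noncomputable def popLoss {d : ℕ} {Ω : Type*} [MeasurableSpace Ω] (P : Measure Ω)
    (X : Ω → Vec d) (g : ℝ → ℝ) (lam : ℝ) (γ : Pr d) : ℝ :=
  (∫ ω, g ((WithLp.equiv 2 (ℝ × Vec d) γ).1 + ⟪(WithLp.equiv 2 (ℝ × Vec d) γ).2, X ω⟫) ∂P)
    + lam / 2 * ((WithLp.equiv 2 (ℝ × Vec d) γ).1) ^ 2

theorem aux_EY {Ω : Type*} [MeasurableSpace Ω] (P : Measure Ω) [IsProbabilityMeasure P]
    (Y : Ω → ℝ) (hY : Measurable Y) (hYpm : ∀ ω, Y ω = 1 ∨ Y ω = -1)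
    (hY1 : P {ω | Y ω = 1} = 1 / 2) : ∫ ω, Y ω ∂P = 0 := by
  have hm : MeasurableSet {ω | Y ω = 1} := hY (measurableSet_singleton 1)
  have h : Y = fun ω => 2 * Set.indicator {ω | Y ω = 1} (fun _ => (1:ℝ)) ω - 1 := by
    funext ω
    by_cases h1 : Y ω = 1
    · simp [Set.indicator, h1]; norm_num
    · have h2 : Y ω = -1 := (hYpm ω).resolve_left h1
      simp [Set.indicator, h2]; norm_num
  have hi : Integrable (Set.indicator {ω | Y ω = 1} (fun _ => (1:ℝ))) P :=
    (integrable_const 1).indicator hm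
  have h2 : ∫ ω, Y ω ∂P
      = ∫ ω, (2 * Set.indicator {ω | Y ω = 1} (fun _ => (1:ℝ)) ω - 1) ∂P :=
    congrArg (fun f : Ω → ℝ => ∫ ω, f ω ∂P) h
  rw [h2, integral_sub (hi.const_mul 2) (integrable_const 1), integral_const_mul,
    integral_indicator hm]
  simp [Measure.real, hY1]

theorem aux_int {d : ℕ} {Ω : Type*} [MeasurableSpace Ω] (P : Measure Ω) [IsProbabilityMeasure P]
    (Z : Ω → Vec d) (hZ : Measurable Z)
    (hZsg : ∀ u : Vec d, ‖u‖ = 1 → ∀ p : ℝ, 1 ≤ p → Integrable (fun ω => |⟪u, Z ω⟫| ^ p) P)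
    (β : Vec d) (k : ℕ) : Integrable (fun ω => ⟪β, Z ω⟫ ^ k) P := by
  rcases Nat.eq_zero_or_pos k with rfl | hk
  · simp
  by_cases hb : β = 0
  · subst hb; simp [hk.ne']
  have hn : ‖β‖ ≠ 0 := norm_ne_zero_iff.2 hb
  have h := hZsg (‖β‖⁻¹ • β) (by rw [norm_smul, norm_inv, norm_norm, inv_mul_cancel₀ hn]) k
    (by exact_mod_cast hk)
  refine (h.const_mul (‖β‖ ^ k)).mono ?_ ?_
  · have : Measurable fun ω => ⟪β, Z ω⟫ ^ k := by fun_prop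
    exact this.aestronglyMeasurable
  · refine Filter.Eventually.of_forall fun ω => le_of_eq ?_
    simp only [Real.rpow_natCast, real_inner_smul_left, abs_mul, norm_mul, norm_pow, norm_norm,
      Real.norm_eq_abs, abs_abs, abs_inv, abs_norm]
    rw [← mul_pow, ← mul_assoc, mul_inv_cancel₀ hn, one_mul]

theorem aux_odd {d : ℕ} {Ω : Type*} [MeasurableSpace Ω] (P : Measure Ω)
    (Z : Ω → Vec d) (hZ : Measurable Z)
    (hZsym : ∀ O : Vec d ≃ₗᵢ[ℝ] Vec d,
      Measure.map (fun ω => O (Z ω)) P = Measure.map Z P)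
    (β : Vec d) (k : ℕ) (hk : Odd k) : ∫ ω, ⟪β, Z ω⟫ ^ k ∂P = 0 := by
  have h := hZsym (LinearIsometryEquiv.neg ℝ)
  have hm : Measurable fun z : Vec d => ⟪β, z⟫ ^ k := by fun_prop
  have h1 := integral_map (μ := P) hZ.aemeasurable (f := fun z : Vec d => ⟪β, z⟫ ^ k)
    hm.aestronglyMeasurable
  have h2 := integral_map (μ := P) (φ := fun ω => (LinearIsometryEquiv.neg ℝ : Vec d ≃ₗᵢ[ℝ] Vec d) (Z ω))
    (by simp only [LinearIsometryEquiv.coe_neg]; fun_prop) (f := fun z : Vec d => ⟪β, z⟫ ^ k)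
    hm.aestronglyMeasurable
  rw [h, h1] at h2
  simp only [LinearIsometryEquiv.coe_neg, inner_neg_right, hk.neg_pow, integral_neg] at h2
  linarith

theorem aux_four {d : ℕ} {Ω : Type*} [MeasurableSpace Ω] (P : Measure Ω)
    (Z : Ω → Vec d) (MZ : ℝ)
    (hMZ : ∀ u : Vec d, ‖u‖ = 1 → (∫ ω, ⟪u, Z ω⟫ ^ 4 ∂P) = MZ)
    (β : Vec d) : ∫ ω, ⟪β, Z ω⟫ ^ 4 ∂P = MZ * (‖β‖ ^ 2) ^ 2 := by
  by_cases hb : β = 0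
  · subst hb; simp
  have hn : ‖β‖ ≠ 0 := norm_ne_zero_iff.2 hb
  have h := hMZ (‖β‖⁻¹ • β) (by rw [norm_smul, norm_inv, norm_norm, inv_mul_cancel₀ hn])
  simp only [real_inner_smul_left, mul_pow, integral_const_mul] at h
  rw [← h]
  field_simp

/-- The closed form of the loss. -/
noncomputable def clo {d : ℕ} (μ : Vec d) (MZ lam : ℝ) (γ : Pr d) : ℝ :=
  (γ.fst ^ 4 + 6 * γ.fst ^ 2 * ⟪γ.snd, μ⟫ ^ 2 + ⟪γ.snd, μ⟫ ^ 4
    + 6 * (γ.fst ^ 2 + ⟪γ.snd, μ⟫ ^ 2) * ‖γ.snd‖ ^ 2 + MZ * (‖γ.snd‖ ^ 2) ^ 2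
    - 2 * (γ.fst ^ 2 + ⟪γ.snd, μ⟫ ^ 2 + ‖γ.snd‖ ^ 2) + 1) / 4 + lam / 2 * γ.fst ^ 2

theorem clo_contDiff {d : ℕ} (μ : Vec d) (MZ lam : ℝ) : ContDiff ℝ 2 (clo μ MZ lam) := by
  have h1 : ContDiff ℝ 2 (fun γ : Pr d => γ.fst) := (WithLp.fstL 2 ℝ ℝ (Vec d)).contDiff
  have h2 : ContDiff ℝ 2 (fun γ : Pr d => γ.snd) := (WithLp.sndL 2 ℝ ℝ (Vec d)).contDiff
  have h3 : ContDiff ℝ 2 (fun γ : Pr d => ⟪γ.snd, μ⟫) := h2.inner ℝ contDiff_const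
  have h4 : ContDiff ℝ 2 (fun γ : Pr d => ‖γ.snd‖ ^ 2) := h2.norm_sq ℝ
  unfold clo
  fun_prop

theorem clo_grad {d : ℕ} (μ : Vec d) (MZ lam : ℝ) (α : ℝ) (β : Vec d) :
    HasGradientAt (clo μ MZ lam)
      (mkp (α * (α ^ 2 + 3 * ⟪β, μ⟫ ^ 2 + 3 * ‖β‖ ^ 2 + lam - 1))
          ((((3 * α ^ 2 + ⟪β, μ⟫ ^ 2 + 3 * ‖β‖ ^ 2 - 1) * ⟪μ, β⟫) • μ)
            + (3 * α ^ 2 + 3 * ⟪μ, β⟫ ^ 2 + MZ * ‖β‖ ^ 2 - 1) • β)) (mkp α β) := by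
  rw [hasGradientAt_iff_hasFDerivAt]
  have h1 : HasFDerivAt (fun γ : Pr d => γ.fst) (WithLp.fstL 2 ℝ ℝ (Vec d)) (mkp α β) :=
    (WithLp.fstL 2 ℝ ℝ (Vec d)).hasFDerivAt
  have h2 : HasFDerivAt (fun γ : Pr d => γ.snd) (WithLp.sndL 2 ℝ ℝ (Vec d)) (mkp α β) :=
    (WithLp.sndL 2 ℝ ℝ (Vec d)).hasFDerivAt
  have h3 := h2.inner ℝ (hasFDerivAt_const μ (mkp α β))
  have h4 := h2.norm_sq
  have h5 := ((((((h1.pow 4).add (((h1.pow 2).const_mul 6).mul (h3.pow 2))).add (h3.pow 4)).add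
    ((((h1.pow 2).add (h3.pow 2)).const_mul 6).mul h4)).add ((h4.pow 2).const_mul MZ)).sub
    ((((h1.pow 2).add (h3.pow 2)).add h4).const_mul 2)).add_const 1 |>.mul_const (1/4 : ℝ)
    |>.add ((h1.pow 2).const_mul (lam / 2))
  refine (h5.congr_fderiv ?_).congr_of_eventuallyEq (Filter.Eventually.of_forall fun γ => ?_)
  · ext v
    simp [mkp, WithLp.prod_inner_apply, inner_add_left, real_inner_smul_left,
      real_inner_comm μ]
    ring
  · simp [clo]; ring

/-- under the centered model, for any `λ ≥ 0`, the quartic population loss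
`L^h_λ` is twice (continuously) differentiable and its gradient is given in closed form:
`∂_α L^h_λ(α,β) = α(α² + 3(β⊤μ)² + 3‖β‖² + λ − 1)` and
`∇_β L^h_λ(α,β) = [3α² + (β⊤μ)² + 3‖β‖² − 1](μ⊤β)μ + [3α² + 3(μ⊤β)² + M_Z‖β‖² − 1]β`. -/
theorem quartic_population_loss_gradient
    {d : ℕ} {Ω : Type*} [MeasurableSpace Ω] (P : Measure Ω) [IsProbabilityMeasure P]
    (Y : Ω → ℝ) (Z : Ω → Vec d) (X : Ω → Vec d) (μ : Vec d) (M MZ lam : ℝ)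
    (hμ : μ ≠ 0) (hlam : 0 ≤ lam)
    (hY : Measurable Y) (hZ : Measurable Z)
    (hYpm : ∀ ω, Y ω = 1 ∨ Y ω = -1)
    (hY1 : P {ω | Y ω = 1} = 1 / 2) (hY2 : P {ω | Y ω = -1} = 1 / 2)
    (hindep : IndepFun Y Z P)
    (hZsg : ∀ u : Vec d, ‖u‖ = 1 → ∀ p : ℝ, 1 ≤ p →
      Integrable (fun ω => |⟪u, Z ω⟫| ^ p) P ∧
        (∫ ω, |⟪u, Z ω⟫| ^ p ∂P) ^ (1 / p) ≤ Real.sqrt p * M)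
    (hZmean : (∫ ω, Z ω ∂P) = 0)
    (hZcov : ∀ u v : Vec d, (∫ ω, ⟪u, Z ω⟫ * ⟪v, Z ω⟫ ∂P) = ⟪u, v⟫)
    (hZsym : ∀ O : Vec d ≃ₗᵢ[ℝ] Vec d,
      Measure.map (fun ω => O (Z ω)) P = Measure.map Z P)
    (hMZ : ∀ u : Vec d, ‖u‖ = 1 → (∫ ω, ⟪u, Z ω⟫ ^ 4 ∂P) = MZ)
    (hX : ∀ ω, X ω = Y ω • μ + Z ω) :
    ContDiff ℝ 2 (popLoss P X hq lam) ∧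
    ∀ (α : ℝ) (β : Vec d),
      gradient (popLoss P X hq lam) (mkp α β) =
        mkp (α * (α ^ 2 + 3 * ⟪β, μ⟫ ^ 2 + 3 * ‖β‖ ^ 2 + lam - 1))
          ((((3 * α ^ 2 + ⟪β, μ⟫ ^ 2 + 3 * ‖β‖ ^ 2 - 1) * ⟪μ, β⟫) • μ)
            + (3 * α ^ 2 + 3 * ⟪μ, β⟫ ^ 2 + MZ * ‖β‖ ^ 2 - 1) • β) := by
  have hEY := aux_EY P Y hY hYpm hY1
  have hint := aux_int P Z hZ (fun u hu p hp => (hZsg u hu p hp).1)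
  have key : popLoss P X hq lam = clo μ MZ lam := by
    funext γ
    set α := γ.fst with hα
    set β := γ.snd with hβ
    set s := ⟪β, μ⟫ with hs
    have i1 : Integrable (fun ω => ⟪β, Z ω⟫) P := by simpa using hint β 1
    have i2 := hint β 2
    have i3 := hint β 3
    have i4 := hint β 4
    have e1 : ∫ ω, ⟪β, Z ω⟫ ∂P = 0 := by simpa using aux_odd P Z hZ hZsym β 1 (by decide)
    have e3 := aux_odd P Z hZ hZsym β 3 (by decide)
    have e2 : ∫ ω, ⟪β, Z ω⟫ ^ 2 ∂P = ‖β‖ ^ 2 := by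
      rw [← real_inner_self_eq_norm_sq, ← hZcov]; simp only [pow_two]
    have e4 := aux_four P Z MZ hMZ β
    let g : Vec d → ℝ := fun z =>
      (⟪β, z⟫ ^ 2 + 2 * α * ⟪β, z⟫ + (α ^ 2 + s ^ 2 - 1)) * (s * (α + ⟪β, z⟫))
    have hg : Measurable g := by fun_prop
    have hgi : Integrable (fun ω => g (Z ω)) P := by
      have : (fun ω => g (Z ω)) = fun ω => s * ⟪β, Z ω⟫ ^ 3 + 3 * α * s * ⟪β, Z ω⟫ ^ 2
          + (2 * α ^ 2 * s + (α ^ 2 + s ^ 2 - 1) * s) * ⟪β, Z ω⟫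
          + (α ^ 2 + s ^ 2 - 1) * s * α := by
        funext ω; simp only [g]; ring
      rw [this]
      exact (((i3.const_mul _).add (i2.const_mul _)).add (i1.const_mul _)).add
        (integrable_const _)
    have hYg : ∫ ω, Y ω * g (Z ω) ∂P = 0 := by
      have hi : IndepFun Y (fun ω => g (Z ω)) P := hindep.comp measurable_id hg
      rw [hi.integral_fun_mul_eq_mul_integral hY.aestronglyMeasurable
        hgi.aestronglyMeasurable, hEY, zero_mul]
    have hYgi : Integrable (fun ω => Y ω * g (Z ω)) P := by
      refine hgi.mono (hY.aestronglyMeasurable.mul hgi.aestronglyMeasurable)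
        (Filter.Eventually.of_forall fun ω => le_of_eq ?_)
      rcases hYpm ω with h | h <;> simp [h]
    have hpt : ∀ ω, hq (α + ⟪β, X ω⟫) =
        (1/4) * ⟪β, Z ω⟫ ^ 4 + α * ⟪β, Z ω⟫ ^ 3
        + ((4 * α ^ 2 + 2 * (α ^ 2 + s ^ 2 - 1) + 4 * s ^ 2) / 4) * ⟪β, Z ω⟫ ^ 2
        + (α * (α ^ 2 + s ^ 2 - 1) + 2 * s ^ 2 * α) * ⟪β, Z ω⟫
        + ((α ^ 2 + s ^ 2 - 1) ^ 2 / 4 + s ^ 2 * α ^ 2) + Y ω * g (Z ω) := by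
      intro ω
      simp only [hX ω, inner_add_right, real_inner_smul_right, hq, g, ← hs]
      rcases hYpm ω with h | h <;> rw [h] <;> ring
    have hL : popLoss P X hq lam γ = (∫ ω, hq (α + ⟪β, X ω⟫) ∂P) + lam / 2 * α ^ 2 := rfl
    rw [hL]
    simp only [hpt]
    have j1 := i4.const_mul (1/4 : ℝ)
    have j2 := j1.add (i3.const_mul α)
    have j3 := j2.add (i2.const_mul ((4 * α ^ 2 + 2 * (α ^ 2 + s ^ 2 - 1) + 4 * s ^ 2) / 4))
    have j4 := j3.add (i1.const_mul (α * (α ^ 2 + s ^ 2 - 1) + 2 * s ^ 2 * α))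
    have j5 := j4.add (integrable_const ((α ^ 2 + s ^ 2 - 1) ^ 2 / 4 + s ^ 2 * α ^ 2))
    erw [integral_add j5 hYgi, integral_add j4 (integrable_const _),
      integral_add j3 (i1.const_mul _), integral_add j2 (i2.const_mul _),
      integral_add j1 (i3.const_mul _)]
    simp only [integral_const_mul, e1, e2, e3, e4, hYg, integral_const]
    simp only [probReal_univ, clo, ← hα, ← hβ, ← hs, smul_eq_mul]
    ring
  rw [key]
  exact ⟨clo_contDiff μ MZ lam, fun α β => (clo_grad μ MZ lam α β).gradient⟩
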